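/- Let g be continuous and even on 𝕊², and let n ∈ ℤ with |n| = 1. Then for almost every t > 0, G_n(arctan t) = t · (1+t²)^{3/2} · (d/dt)[ t · ∫_t^{∞} H_n(r) / ( r² · √(r²−t²) ) dr ]. -/

import Mathlib

open MeasureTheory Real Filter Set Topology ENNReal NNReal

/-- `g : ℝ × ℝ → ℂ` (spherical coordinates) is continuous on `𝕊²`, i.e. induced by a
continuous function on (an extension of) the unit sphere of `ℝ³`. -/
def ContOnSphere (g : ℝ → ℝ → ℂ) : Prop :=
  ∃ G : ℝ × ℝ × ℝ → ℂ, Continuous G ∧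
    ∀ θ ρ : ℝ, g θ ρ = G (Real.cos θ * Real.sin ρ, Real.sin θ * Real.sin ρ, Real.cos ρ)

/-- The dual transform `R*g`. -/
noncomputable def RStar (g : ℝ → ℝ → ℂ) (s t : ℝ) : ℂ :=
  (1 / π) *
    ((∫ v in Set.Ioi (0:ℝ),
        g (s + Real.arccos (-t / Real.sqrt (v ^ 2 + t ^ 2)))
            (Real.arctan (Real.sqrt (v ^ 2 + t ^ 2))) *
          (((1 + v ^ 2 + t ^ 2) ^ (-(3:ℝ) / 2) : ℝ) : ℂ)) +
     (∫ v in Set.Ioi (0:ℝ),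
        g (s + (-1) * Real.arccos (-t / Real.sqrt (v ^ 2 + t ^ 2)))
            (Real.arctan (Real.sqrt (v ^ 2 + t ^ 2))) *
          (((1 + v ^ 2 + t ^ 2) ^ (-(3:ℝ) / 2) : ℝ) : ℂ)))

/-- `n`-th Fourier coefficient of a function on the sphere (in the variable θ). -/
noncomputable def Gs (g : ℝ → ℝ → ℂ) (n : ℤ) (ρ : ℝ) : ℂ :=
  (1 / (2 * π)) * ∫ θ in (0:ℝ)..(2 * π), g θ ρ * Complex.exp (-Complex.I * n * θ)

/-- `n`-th Fourier coefficient of `R*g` (in the variable s). -/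
noncomputable def Hc (g : ℝ → ℝ → ℂ) (n : ℤ) (t : ℝ) : ℂ :=
  (1 / (2 * π)) * ∫ s in (0:ℝ)..(2 * π), RStar g s t * Complex.exp (-Complex.I * n * s)

theorem hasDerivAt_neg_arcsin_abel {τ q r : ℝ} (hτ : 0 < τ) (hr : τ < r) (hq : r < q) :
    HasDerivAt (fun r => -arcsin (τ * √(q ^ 2 - r ^ 2) / (r * √(q ^ 2 - τ ^ 2))) / (q * τ))
      (1 / (r * √(q ^ 2 - r ^ 2) * √(r ^ 2 - τ ^ 2))) r := by
  have hr0 : 0 < r := hτ.trans hr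
  have hq0 : 0 < q := hr0.trans hq
  have h1 : 0 < q ^ 2 - r ^ 2 := by nlinarith
  have h2 : 0 < r ^ 2 - τ ^ 2 := by nlinarith
  have h3 : 0 < q ^ 2 - τ ^ 2 := by linarith
  obtain ⟨s, hs⟩ : ∃ s, s = √(q ^ 2 - r ^ 2) := ⟨_, rfl⟩
  obtain ⟨m, hm⟩ : ∃ m, m = √(r ^ 2 - τ ^ 2) := ⟨_, rfl⟩
  obtain ⟨b, hb⟩ : ∃ b, b = √(q ^ 2 - τ ^ 2) := ⟨_, rfl⟩
  have hs0 : 0 < s := hs ▸ sqrt_pos.2 h1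
  have hm0 : 0 < m := hm ▸ sqrt_pos.2 h2
  have hb0 : 0 < b := hb ▸ sqrt_pos.2 h3
  have hs2 : s ^ 2 = q ^ 2 - r ^ 2 := hs ▸ sq_sqrt h1.le
  have hm2 : m ^ 2 = r ^ 2 - τ ^ 2 := hm ▸ sq_sqrt h2.le
  have hb2 : b ^ 2 = q ^ 2 - τ ^ 2 := hb ▸ sq_sqrt h3.le
  have hsq : 1 - (τ * s / (r * b)) ^ 2 = (q * m / (r * b)) ^ 2 := by
    field_simp
    rw [hs2, hm2, hb2]; ring
  have hpos : 0 < q * m / (r * b) := by positivity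
  have hw0 : 0 < τ * s / (r * b) := by positivity
  have hw1 : τ * s / (r * b) ≠ 1 := by
    intro h; rw [h] at hsq; nlinarith
  have hroot : HasDerivAt (fun r => √(q ^ 2 - r ^ 2)) (-(2 * r) / (2 * s)) r := by
    rw [hs]
    refine HasDerivAt.sqrt ?_ h1.ne'
    simpa using (hasDerivAt_pow 2 r).const_sub (q ^ 2)
  have hw : HasDerivAt (fun r => τ * √(q ^ 2 - r ^ 2) / (r * √(q ^ 2 - τ ^ 2)))
      ((τ * (-(2 * r) / (2 * s)) * (r * b) - τ * s * (1 * b)) / (r * b) ^ 2) r := by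
    rw [← hb]
    have := (hroot.const_mul τ).div ((hasDerivAt_id r).mul_const b) (mul_pos hr0 hb0).ne'
    rw [← hs] at this
    exact this
  have harc := (hasDerivAt_arcsin (x := τ * s / (r * b)) (by linarith) hw1)
  rw [hsq, sqrt_sq hpos.le] at harc
  have harc' : HasDerivAt arcsin (1 / (q * m / (r * b)))
      ((fun r => τ * √(q ^ 2 - r ^ 2) / (r * √(q ^ 2 - τ ^ 2))) r) := by
    simpa only [← hs, ← hb] using harc
  have := ((harc'.comp r hw).neg).div_const (q * τ)
  refine this.congr_deriv ?_
  rw [← hs, ← hm]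
  field_simp
  linear_combination hs2

theorem integral_abel_kernel {τ q : ℝ} (hτ : 0 < τ) (hq : τ < q) :
    IntegrableOn (fun r => 1 / (r * √(q ^ 2 - r ^ 2) * √(r ^ 2 - τ ^ 2))) (Ioi τ) ∧
    ∫ r in Ioi τ, 1 / (r * √(q ^ 2 - r ^ 2) * √(r ^ 2 - τ ^ 2)) = π / (2 * q * τ) := by
  have hzero : ∀ r ∈ Ioi τ \ Ioc τ q,
      1 / (r * √(q ^ 2 - r ^ 2) * √(r ^ 2 - τ ^ 2)) = 0 := by
    rintro r ⟨hr, hr'⟩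
    have hr1 : τ < r := hr
    have : q < r := by
      by_contra! h
      exact hr' ⟨hr, h⟩
    rw [sqrt_eq_zero_of_nonpos (by nlinarith)]; simp
  have hb : 0 < √(q ^ 2 - τ ^ 2) := sqrt_pos.2 (by nlinarith)
  have hcont : ContinuousOn
      (fun r => -arcsin (τ * √(q ^ 2 - r ^ 2) / (r * √(q ^ 2 - τ ^ 2))) / (q * τ)) (Icc τ q) := by
    refine ContinuousOn.div_const (ContinuousOn.neg (continuous_arcsin.comp_continuousOn ?_)) _
    refine ContinuousOn.div (by fun_prop) (by fun_prop) ?_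
    intro r hr
    have : 0 < r := hτ.trans_le hr.1
    positivity
  have hderiv : ∀ r ∈ Ioo τ q, HasDerivAt
      (fun r => -arcsin (τ * √(q ^ 2 - r ^ 2) / (r * √(q ^ 2 - τ ^ 2))) / (q * τ))
      (1 / (r * √(q ^ 2 - r ^ 2) * √(r ^ 2 - τ ^ 2))) r :=
    fun r hr => hasDerivAt_neg_arcsin_abel hτ hr.1 hr.2
  have hint : IntegrableOn (fun r => 1 / (r * √(q ^ 2 - r ^ 2) * √(r ^ 2 - τ ^ 2))) (Ioc τ q) := by
    refine intervalIntegral.integrableOn_deriv_of_nonneg hcont hderiv fun r hr => ?_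
    have : 0 < r := hτ.trans hr.1
    positivity
  refine ⟨hint.of_forall_sdiff_eq_zero measurableSet_Ioi hzero, ?_⟩
  rw [setIntegral_eq_of_subset_of_forall_sdiff_eq_zero measurableSet_Ioi Ioc_subset_Ioi_self hzero,
    ← intervalIntegral.integral_of_le hq.le,
    intervalIntegral.integral_eq_sub_of_hasDerivAt_of_le hq.le hcont hderiv
      ((intervalIntegrable_iff_integrableOn_Ioc_of_le hq.le).2 hint)]
  have : τ * √(q ^ 2 - τ ^ 2) / (τ * √(q ^ 2 - τ ^ 2)) = 1 := div_self (by positivity)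
  have hq0 : 0 < q := hτ.trans hq
  simp only [this, sub_self, Real.sqrt_zero, mul_zero, zero_div, arcsin_zero, arcsin_one]
  field_simp
  ring

theorem integral_Ioi_comp_sqrt_sq_add_sq {r : ℝ} (hr : 0 < r) (f : ℝ → ℂ) :
    ∫ v in Ioi (0 : ℝ), f √(v ^ 2 + r ^ 2) * ((1 / √(v ^ 2 + r ^ 2) : ℝ) : ℂ) =
      ∫ q in Ioi r, f q * ((1 / √(q ^ 2 - r ^ 2) : ℝ) : ℂ) := by
  have himage : (fun q => √(q ^ 2 - r ^ 2)) '' Ioi r = Ioi 0 := by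
    ext v
    simp only [mem_image, mem_Ioi]
    constructor
    · rintro ⟨q, hq, rfl⟩
      exact sqrt_pos.2 (by nlinarith)
    · intro hv
      refine ⟨√(v ^ 2 + r ^ 2), lt_sqrt_of_sq_lt (by nlinarith), ?_⟩
      rw [sq_sqrt (by positivity), add_sub_cancel_right, sqrt_sq hv.le]
  have hinj : InjOn (fun q => √(q ^ 2 - r ^ 2)) (Ioi r) := by
    intro a ha b hb h
    simp only [mem_Ioi] at ha hb
    have := (sqrt_inj (by nlinarith) (by nlinarith)).1 h
    exact (pow_left_inj₀ (hr.trans ha).le (hr.trans hb).le two_ne_zero).1 (by linarith)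
  have hderiv : ∀ q ∈ Ioi r, HasDerivWithinAt (fun q => √(q ^ 2 - r ^ 2))
      (2 * q / (2 * √(q ^ 2 - r ^ 2))) (Ioi r) q := by
    intro q hq
    simp only [mem_Ioi] at hq
    refine (HasDerivAt.sqrt ?_ (by nlinarith)).hasDerivWithinAt
    simpa using (hasDerivAt_pow 2 q).sub_const (r ^ 2)
  rw [← himage, integral_image_eq_integral_abs_deriv_smul measurableSet_Ioi hderiv hinj]
  refine setIntegral_congr_fun measurableSet_Ioi fun q hq => ?_
  simp only [mem_Ioi] at hq
  have hq0 : 0 < q := hr.trans hq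
  have hm : 0 < √(q ^ 2 - r ^ 2) := sqrt_pos.2 (by nlinarith)
  rw [sq_sqrt (by nlinarith), sub_add_cancel, sqrt_sq hq0.le, abs_of_nonneg (by positivity),
    Complex.real_smul]
  have hqc : (q : ℂ) ≠ 0 := by exact_mod_cast hq0.ne'
  push_cast
  field_simp

theorem integral_abel_inversion {τ : ℝ} (hτ : 0 < τ) {f : ℝ → ℂ} (hf : Continuous f)
    (hint : IntegrableOn (fun q => f q * ((1 / q : ℝ) : ℂ)) (Ioi τ)) :
    ∫ r in Ioi τ, (∫ q in Ioi r, f q * ((1 / √(q ^ 2 - r ^ 2) : ℝ) : ℂ)) *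
        ((1 / (r * √(r ^ 2 - τ ^ 2)) : ℝ) : ℂ) =
      ((π / (2 * τ) : ℝ) : ℂ) * ∫ q in Ioi τ, f q * ((1 / q : ℝ) : ℂ) := by
  have hswap : Integrable (Function.uncurry fun r q : ℝ =>
      f q * ((1 / (r * √(q ^ 2 - r ^ 2) * √(r ^ 2 - τ ^ 2)) : ℝ) : ℂ))
      ((volume.restrict (Ioi τ)).prod (volume.restrict (Ioi τ))) := by
    rw [integrable_prod_iff']
    · constructor
      · refine (ae_restrict_mem measurableSet_Ioi).mono fun q hq => ?_
        exact ((integral_abel_kernel hτ hq).1.ofReal (𝕜 := ℂ)).const_mul (f q)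
      · refine (hint.norm.const_mul (π / (2 * τ))).congr ?_
        refine (ae_restrict_mem measurableSet_Ioi).mono fun q hq => ?_
        simp only [Function.uncurry, norm_mul]
        rw [integral_const_mul]
        have hq0 : 0 < q := hτ.trans hq
        have : ∫ r in Ioi τ, ‖((1 / (r * √(q ^ 2 - r ^ 2) * √(r ^ 2 - τ ^ 2)) : ℝ) : ℂ)‖ =
            π / (2 * q * τ) := by
          rw [← (integral_abel_kernel hτ hq).2]
          refine setIntegral_congr_fun measurableSet_Ioi fun r hr => ?_
          have : 0 < r := hτ.trans hr
          exact (Complex.norm_real _).trans (norm_of_nonneg (by positivity))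
        rw [this, Complex.norm_real, norm_of_nonneg (by positivity)]
        field_simp
    · refine Measurable.aestronglyMeasurable ?_
      have := hf.measurable
      unfold Function.uncurry
      fun_prop
  calc
    _ = ∫ r in Ioi τ, ∫ q in Ioi τ,
        f q * ((1 / (r * √(q ^ 2 - r ^ 2) * √(r ^ 2 - τ ^ 2)) : ℝ) : ℂ) := by
      refine setIntegral_congr_fun measurableSet_Ioi fun r hr => ?_
      simp only [mem_Ioi] at hr
      have hr0 : 0 < r := hτ.trans hr
      rw [← integral_mul_const, eq_comm, setIntegral_eq_of_subset_of_forall_sdiff_eq_zero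
        measurableSet_Ioi (Ioi_subset_Ioi hr.le)]
      · congr 1 with q
        push_cast
        simp only [one_div, mul_inv]
        ring
      · rintro q ⟨hq, hq'⟩
        simp only [mem_Ioi, not_lt] at hq hq'
        rw [sqrt_eq_zero_of_nonpos (by nlinarith)]
        simp
    _ = ∫ q in Ioi τ, ∫ r in Ioi τ,
        f q * ((1 / (r * √(q ^ 2 - r ^ 2) * √(r ^ 2 - τ ^ 2)) : ℝ) : ℂ) :=
      integral_integral_swap hswap
    _ = _ := by
      rw [← integral_const_mul]
      refine setIntegral_congr_fun measurableSet_Ioi fun q hq => ?_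
      rw [integral_const_mul, integral_complex_ofReal, (integral_abel_kernel hτ hq).2]
      push_cast
      have hq0 : (q : ℂ) ≠ 0 := by exact_mod_cast (hτ.trans hq).ne'
      have ht0 : (τ : ℂ) ≠ 0 := by exact_mod_cast hτ.ne'
      field_simp

theorem hasDerivAt_integral_Ioi {a t : ℝ} (hat : a < t) {f : ℝ → ℂ}
    (hf : ContinuousOn f (Ioi a)) (hint : IntegrableOn f (Ioi a)) :
    HasDerivAt (fun τ => ∫ q in Ioi τ, f q) (-f t) t := by
  have hder : HasDerivAt (fun τ => ∫ q in a..τ, f q) (f t) t := by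
    refine intervalIntegral.integral_hasDerivAt_right ?_ ?_ (hf.continuousAt (Ioi_mem_nhds hat))
    · exact (intervalIntegrable_iff_integrableOn_Ioc_of_le hat.le).2
        (hint.mono_set Ioc_subset_Ioi_self)
    · exact hf.stronglyMeasurableAtFilter isOpen_Ioi t hat
  refine ((hder.const_sub (∫ q in Ioi a, f q))).congr_of_eventuallyEq ?_
  filter_upwards [Ioi_mem_nhds hat] with τ hτ
  have hτ' : a ≤ τ := le_of_lt hτ
  rw [← intervalIntegral.integral_interval_add_Ioi hint (hint.mono_set (Ioi_subset_Ioi hτ'))]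
  ring

theorem ContOnSphere.continuous_uncurry {g : ℝ → ℝ → ℂ} (hg : ContOnSphere g) :
    Continuous (Function.uncurry g) := by
  obtain ⟨G, hG, h⟩ := hg
  have : Function.uncurry g = fun p : ℝ × ℝ =>
      G (cos p.1 * sin p.2, sin p.1 * sin p.2, cos p.2) := by
    ext p
    exact h p.1 p.2
  rw [this]
  fun_prop

theorem ContOnSphere.exists_norm_le {g : ℝ → ℝ → ℂ} (hg : ContOnSphere g) :
    ∃ M, ∀ θ ρ, ‖g θ ρ‖ ≤ M := by
  obtain ⟨G, hG, h⟩ := hg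
  obtain ⟨M, hM⟩ := (isCompact_closedBall (0 : ℝ × ℝ × ℝ) 1).exists_bound_of_continuousOn
    hG.continuousOn
  refine ⟨M, fun θ ρ => ?_⟩
  rw [h]
  refine hM _ ?_
  have h1 : ∀ x y : ℝ, |x| ≤ 1 → |y| ≤ 1 → |x * y| ≤ 1 := fun x y hx hy => by
    rw [abs_mul]; exact mul_le_one₀ hx (abs_nonneg _) hy
  simp only [mem_closedBall_zero_iff, Prod.norm_def, Real.norm_eq_abs, sup_le_iff]
  exact ⟨h1 _ _ (abs_cos_le_one _) (abs_sin_le_one _),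
    h1 _ _ (abs_sin_le_one _) (abs_sin_le_one _), abs_cos_le_one _⟩

theorem ContOnSphere.periodic {g : ℝ → ℝ → ℂ} (hg : ContOnSphere g) (θ ρ : ℝ) :
    g (θ + 2 * π) ρ = g θ ρ := by
  obtain ⟨G, -, h⟩ := hg
  simp only [h, cos_add_two_pi, sin_add_two_pi]

theorem norm_exp_neg_I_mul_int_mul (n : ℤ) (s : ℝ) : ‖Complex.exp (-Complex.I * n * s)‖ = 1 := by
  have : -Complex.I * n * s = ((-(n * s) : ℝ) : ℂ) * Complex.I := by push_cast; ring
  rw [this, Complex.norm_exp_ofReal_mul_I]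

theorem integral_shift_mul_exp {g : ℝ → ℝ → ℂ} (hg : ContOnSphere g) (n : ℤ) (β ρ : ℝ) :
    ∫ s in (0 : ℝ)..(2 * π), g (s + β) ρ * Complex.exp (-Complex.I * n * s) =
      2 * π * Gs g n ρ * Complex.exp (Complex.I * n * β) := by
  have hper : Function.Periodic (fun s : ℝ => g s ρ * Complex.exp (-Complex.I * n * s)) (2 * π) := by
    intro s
    have : -Complex.I * n * ((s + 2 * π : ℝ) : ℂ) =
        -Complex.I * n * s - n * (2 * π * Complex.I) := by push_cast; ring
    simp only [hg.periodic, this, Complex.exp_sub, Complex.exp_int_mul_two_pi_mul_I, div_one]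
  have hshift : ∀ s : ℝ, g (s + β) ρ * Complex.exp (-Complex.I * n * s) =
      (fun s : ℝ => g s ρ * Complex.exp (-Complex.I * n * s)) (s + β) *
        Complex.exp (Complex.I * n * β) := by
    intro s
    simp only
    rw [mul_assoc (g (s + β) ρ), ← Complex.exp_add]
    congr 2
    push_cast
    ring
  simp_rw [hshift]
  rw [intervalIntegral.integral_mul_const, intervalIntegral.integral_comp_add_right
    (fun s : ℝ => g s ρ * Complex.exp (-Complex.I * n * s)), zero_add, add_comm (2 * π) β,
    hper.intervalIntegral_add_eq β 0, zero_add, Gs]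
  have : (π : ℂ) ≠ 0 := by exact_mod_cast Real.pi_ne_zero
  field_simp

theorem continuous_Gs {g : ℝ → ℝ → ℂ} (hg : ContOnSphere g) (n : ℤ) : Continuous (Gs g n) := by
  have h := hg.continuous_uncurry
  refine continuous_const.mul
    (intervalIntegral.continuous_parametric_intervalIntegral_of_continuous' ?_ _ _)
  have : Continuous fun p : ℝ × ℝ => g p.2 p.1 := h.comp continuous_swap
  unfold Function.uncurry
  fun_prop

theorem norm_Gs_le {g : ℝ → ℝ → ℂ} {M : ℝ} (hM : ∀ θ ρ, ‖g θ ρ‖ ≤ M) (n : ℤ) (ρ : ℝ) :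
    ‖Gs g n ρ‖ ≤ M := by
  have h : ‖∫ θ in (0 : ℝ)..(2 * π), g θ ρ * Complex.exp (-Complex.I * n * θ)‖ ≤
      M * |2 * π - 0| :=
    intervalIntegral.norm_integral_le_of_norm_le_const fun θ _ => by
      rw [norm_mul, norm_exp_neg_I_mul_int_mul, mul_one]
      exact hM θ ρ
  rw [sub_zero, abs_of_pos two_pi_pos] at h
  have h2 : ‖(1 / (2 * π) : ℂ)‖ = 1 / (2 * π) := by
    have : (1 / (2 * π) : ℂ) = ((1 / (2 * π) : ℝ) : ℂ) := by push_cast; ring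
    rw [this, Complex.norm_real, norm_of_nonneg (by positivity)]
  rw [Gs, norm_mul, h2, one_div, inv_mul_le_iff₀ two_pi_pos]
  linarith

theorem integral_fourier_swap {g : ℝ → ℝ → ℂ} (hg : ContOnSphere g) (n : ℤ) {α ρ w : ℝ → ℝ}
    (hα : Measurable α) (hρ : Measurable ρ) (hw : IntegrableOn w (Ioi 0)) :
    IntervalIntegrable (fun s : ℝ => (∫ v in Ioi (0 : ℝ), g (s + α v) (ρ v) * (w v : ℂ)) *
      Complex.exp (-Complex.I * n * s)) volume 0 (2 * π) ∧
    IntegrableOn (fun v => 2 * π * Gs g n (ρ v) * Complex.exp (Complex.I * n * α v) * (w v : ℂ))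
      (Ioi 0) ∧
    ∫ s in (0 : ℝ)..(2 * π), (∫ v in Ioi (0 : ℝ), g (s + α v) (ρ v) * (w v : ℂ)) *
        Complex.exp (-Complex.I * n * s) =
      ∫ v in Ioi (0 : ℝ),
        2 * π * Gs g n (ρ v) * Complex.exp (Complex.I * n * α v) * (w v : ℂ) := by
  obtain ⟨M, hM⟩ := hg.exists_norm_le
  have hint : Integrable (Function.uncurry fun s v : ℝ =>
      g (s + α v) (ρ v) * Complex.exp (-Complex.I * n * s) * (w v : ℂ))
      ((volume.restrict (uIoc 0 (2 * π))).prod (volume.restrict (Ioi 0))) := by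
    rw [uIoc_of_le two_pi_pos.le]
    have h1 : Integrable (fun p : ℝ × ℝ => (1 : ℂ) * (w p.2 : ℂ))
        ((volume.restrict (Ioc 0 (2 * π))).prod (volume.restrict (Ioi 0))) :=
      Integrable.mul_prod (f := fun _ : ℝ => (1 : ℂ)) (g := fun v => (w v : ℂ))
        (integrable_const _) hw.ofReal
    simp only [one_mul] at h1
    refine h1.bdd_mul (c := M) (f := fun p : ℝ × ℝ =>
      g (p.1 + α p.2) (ρ p.2) * Complex.exp (-Complex.I * n * p.1)) ?_ ?_
    · have h2 : Measurable fun p : ℝ × ℝ => g (p.1 + α p.2) (ρ p.2) :=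
        hg.continuous_uncurry.measurable.comp
          ((measurable_fst.add (hα.comp measurable_snd)).prodMk (hρ.comp measurable_snd))
      exact Measurable.aestronglyMeasurable (h2.mul (by fun_prop))
    · refine Eventually.of_forall fun p => ?_
      rw [norm_mul, norm_exp_neg_I_mul_int_mul, mul_one]
      exact hM _ _
  have hleft : ∀ s : ℝ, (∫ v in Ioi (0 : ℝ), g (s + α v) (ρ v) * (w v : ℂ)) *
      Complex.exp (-Complex.I * n * s) = ∫ v in Ioi (0 : ℝ),
        g (s + α v) (ρ v) * Complex.exp (-Complex.I * n * s) * (w v : ℂ) := by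
    intro s
    rw [← integral_mul_const]
    congr 1 with v
    ring
  have hright : ∀ v : ℝ, 2 * π * Gs g n (ρ v) * Complex.exp (Complex.I * n * α v) * (w v : ℂ) =
      ∫ s in (0 : ℝ)..(2 * π),
        g (s + α v) (ρ v) * Complex.exp (-Complex.I * n * s) * (w v : ℂ) := by
    intro v
    rw [intervalIntegral.integral_mul_const, integral_shift_mul_exp hg]
  simp_rw [hleft, hright]
  refine ⟨?_, ?_, intervalIntegral_integral_swap hint⟩
  · rw [intervalIntegrable_iff]
    exact hint.integral_prod_left
  · rw [uIoc_of_le two_pi_pos.le] at hint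
    simp_rw [intervalIntegral.integral_of_le two_pi_pos.le]
    exact hint.integral_prod_right

theorem rpow_neg_three_halves_le {x : ℝ} (hx : 1 ≤ x) : x ^ (-(3 : ℝ) / 2) ≤ x⁻¹ := by
  rw [← Real.rpow_neg_one]
  exact rpow_le_rpow_of_exponent_le hx (by norm_num)

theorem Hc_eq_abel {g : ℝ → ℝ → ℂ} (hg : ContOnSphere g) {n : ℤ} (hn : |n| = 1) {t : ℝ}
    (ht : 0 < t) :
    Hc g n t = -(2 * t / π) * ∫ q in Ioi t,
      (Gs g n (arctan q) * (((1 + q ^ 2) ^ (-(3 : ℝ) / 2) : ℝ) : ℂ)) *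
        ((1 / √(q ^ 2 - t ^ 2) : ℝ) : ℂ) := by
  have hw : IntegrableOn (fun v : ℝ => (1 + v ^ 2 + t ^ 2) ^ (-(3 : ℝ) / 2)) (Ioi 0) := by
    refine Integrable.integrableOn (integrable_inv_one_add_sq.mono' ?_ ?_)
    · exact Measurable.aestronglyMeasurable (by fun_prop)
    · refine Eventually.of_forall fun v => ?_
      rw [norm_of_nonneg (by positivity)]
      exact (rpow_neg_three_halves_le (by nlinarith [sq_nonneg v, sq_nonneg t])).trans
        (inv_anti₀ (by positivity) (by nlinarith [sq_nonneg t]))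
  have hρ : Measurable fun v : ℝ => arctan √(v ^ 2 + t ^ 2) := by fun_prop
  have hα : Measurable fun v : ℝ => arccos (-t / √(v ^ 2 + t ^ 2)) :=
    continuous_arccos.measurable.comp (by fun_prop)
  obtain ⟨hi₁, hj₁, he₁⟩ := integral_fourier_swap hg n hα hρ hw
  obtain ⟨hi₂, hj₂, he₂⟩ := integral_fourier_swap hg n (hα.const_mul (-1)) hρ hw
  have hsum : ∫ s in (0 : ℝ)..(2 * π), RStar g s t * Complex.exp (-Complex.I * n * s) =
      1 / π * ∫ v in Ioi (0 : ℝ), (-(4 * π * t) : ℂ) *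
        ((Gs g n (arctan √(v ^ 2 + t ^ 2)) *
          (((1 + √(v ^ 2 + t ^ 2) ^ 2) ^ (-(3 : ℝ) / 2) : ℝ) : ℂ)) *
          ((1 / √(v ^ 2 + t ^ 2) : ℝ) : ℂ)) := by
    simp_rw [RStar, mul_assoc (1 / (π : ℂ)), add_mul]
    rw [intervalIntegral.integral_const_mul, intervalIntegral.integral_add hi₁ hi₂, he₁, he₂,
      ← integral_add hj₁ hj₂]
    congr 1
    refine setIntegral_congr_fun measurableSet_Ioi fun v hv => ?_
    have hq : 0 < v ^ 2 + t ^ 2 := by positivity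
    have hq' : t ≤ √(v ^ 2 + t ^ 2) := le_sqrt_of_sq_le (by nlinarith [sq_nonneg v])
    have hq0 : 0 < √(v ^ 2 + t ^ 2) := ht.trans_le hq'
    have hcos : cos (arccos (-t / √(v ^ 2 + t ^ 2))) = -t / √(v ^ 2 + t ^ 2) :=
      cos_arccos (by rw [le_div_iff₀ hq0]; linarith) (by rw [div_le_iff₀ hq0]; linarith)
    have hexp : ∀ x : ℝ, Complex.exp (Complex.I * n * x) +
        Complex.exp (Complex.I * n * ((-1 * x : ℝ) : ℂ)) = 2 * (cos x : ℂ) := by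
      intro x
      rw [Complex.ofReal_cos, Complex.two_cos]
      rcases (_root_.abs_eq zero_le_one).1 hn with rfl | rfl
      · push_cast
        ring_nf
      · push_cast
        ring_nf
    rw [← add_mul, ← mul_add, hexp, hcos, sq_sqrt hq.le, ← add_assoc]
    push_cast
    ring
  rw [Hc, hsum, integral_const_mul, integral_Ioi_comp_sqrt_sq_add_sq ht
    (fun q => Gs g n (arctan q) * (((1 + q ^ 2) ^ (-(3 : ℝ) / 2) : ℝ) : ℂ))]
  have : (π : ℂ) ≠ 0 := by exact_mod_cast Real.pi_ne_zero
  field_simp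
  ring

/-- inversion of `R*` on Fourier coefficients, case `|n| = 1`. -/
theorem statement11 (g : ℝ → ℝ → ℂ)
    (hg_cont : ContOnSphere g)
    (hg_even : ∀ θ ρ : ℝ, g (θ + π) (π - ρ) = g θ ρ)
    (n : ℤ) (hn : |n| = 1) :
    ∀ᵐ t ∂(volume.restrict (Set.Ioi (0:ℝ))),
      Gs g n (Real.arctan t) =
        (t : ℂ) * (((1 + t ^ 2) ^ ((3:ℝ) / 2) : ℝ) : ℂ) *
          deriv (fun τ : ℝ => (τ : ℂ) *
            ∫ r in Set.Ioi τ, Hc g n r *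
              ((1 / (r ^ 2 * Real.sqrt (r ^ 2 - τ ^ 2)) : ℝ) : ℂ)) t := by
  refine (ae_restrict_mem measurableSet_Ioi).mono fun t ht => ?_
  simp only [mem_Ioi] at ht
  obtain ⟨M, hM⟩ := hg_cont.exists_norm_le
  obtain ⟨F, hF⟩ : ∃ F : ℝ → ℂ, F = fun q =>
    Gs g n (arctan q) * (((1 + q ^ 2) ^ (-(3 : ℝ) / 2) : ℝ) : ℂ) := ⟨_, rfl⟩
  have hFcont : Continuous F := by
    rw [hF]
    refine ((continuous_Gs hg_cont n).comp continuous_arctan).mul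
      (Complex.continuous_ofReal.comp ?_)
    exact Continuous.rpow_const (by fun_prop) fun q => Or.inl (by positivity)
  have hFdiv : ∀ τ : ℝ, 0 < τ → IntegrableOn (fun q => F q * ((1 / q : ℝ) : ℂ)) (Ioi τ) := by
    intro τ hτ
    refine (integrable_inv_one_add_sq.integrableOn.const_mul (M / τ)).mono' ?_ ?_
    · have := hFcont.measurable
      exact Measurable.aestronglyMeasurable (by fun_prop)
    · refine (ae_restrict_mem measurableSet_Ioi).mono fun q hq => ?_
      simp only [mem_Ioi] at hq
      have hq0 : 0 < q := hτ.trans hq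
      have hM0 : 0 ≤ M := (norm_nonneg _).trans (hM 0 0)
      rw [hF, norm_mul, norm_mul, Complex.norm_real, Complex.norm_real,
        norm_of_nonneg (by positivity), norm_of_nonneg (by positivity)]
      calc _ ≤ M * (1 + q ^ 2)⁻¹ * (1 / τ) := by
            gcongr
            · exact norm_Gs_le hM n _
            · exact rpow_neg_three_halves_le (by nlinarith [sq_nonneg q])
        _ = _ := by ring
  have hpi : (π : ℂ) ≠ 0 := by exact_mod_cast Real.pi_ne_zero
  have hformula : ∀ τ : ℝ, 0 < τ → (τ : ℂ) * ∫ r in Ioi τ, Hc g n r *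
      ((1 / (r ^ 2 * √(r ^ 2 - τ ^ 2)) : ℝ) : ℂ) = -∫ q in Ioi τ, F q * ((1 / q : ℝ) : ℂ) := by
    intro τ hτ
    have hτ0 : (τ : ℂ) ≠ 0 := by exact_mod_cast hτ.ne'
    have : ∫ r in Ioi τ, Hc g n r * ((1 / (r ^ 2 * √(r ^ 2 - τ ^ 2)) : ℝ) : ℂ) =
        ∫ r in Ioi τ, -(2 / π : ℂ) * ((∫ q in Ioi r, F q * ((1 / √(q ^ 2 - r ^ 2) : ℝ) : ℂ)) *
          ((1 / (r * √(r ^ 2 - τ ^ 2)) : ℝ) : ℂ)) := by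
      refine setIntegral_congr_fun measurableSet_Ioi fun r hr => ?_
      simp only [mem_Ioi] at hr
      have hr0 : 0 < r := hτ.trans hr
      have hrc : (r : ℂ) ≠ 0 := by exact_mod_cast hr0.ne'
      simp only [Hc_eq_abel hg_cont hn hr0, hF]
      push_cast
      simp only [one_div, mul_inv]
      field_simp
    rw [this, integral_const_mul, integral_abel_inversion hτ hFcont (hFdiv τ hτ)]
    push_cast
    field_simp
  have hderiv : HasDerivAt (fun τ : ℝ => -∫ q in Ioi τ, F q * ((1 / q : ℝ) : ℂ))
      (F t * ((1 / t : ℝ) : ℂ)) t := by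
    have hcont : ContinuousOn (fun q => F q * ((1 / q : ℝ) : ℂ)) (Ioi (t / 2)) := by
      refine hFcont.continuousOn.mul (Complex.continuous_ofReal.comp_continuousOn ?_)
      refine continuousOn_const.div continuousOn_id fun q hq => ?_
      exact ((half_pos ht).trans hq).ne'
    exact (hasDerivAt_integral_Ioi (half_lt_self ht) hcont (hFdiv _ (half_pos ht))).neg.congr_deriv
      (neg_neg _)
  have heq : (fun τ : ℝ => (τ : ℂ) * ∫ r in Ioi τ, Hc g n r *
      ((1 / (r ^ 2 * √(r ^ 2 - τ ^ 2)) : ℝ) : ℂ)) =ᶠ[𝓝 t]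
      fun τ => -∫ q in Ioi τ, F q * ((1 / q : ℝ) : ℂ) := by
    filter_upwards [Ioi_mem_nhds ht] with τ hτ using hformula τ hτ
  have hpow : (1 + t ^ 2) ^ ((3 : ℝ) / 2) * (1 + t ^ 2) ^ (-(3 : ℝ) / 2) = 1 := by
    rw [← rpow_add (by positivity)]
    norm_num
  have hpow' : (((1 + t ^ 2) ^ ((3 : ℝ) / 2) : ℝ) : ℂ) *
      (((1 + t ^ 2) ^ (-(3 : ℝ) / 2) : ℝ) : ℂ) = 1 := by
    rw [← Complex.ofReal_mul, hpow, Complex.ofReal_one]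
  have htc : (t : ℂ) * ((1 / t : ℝ) : ℂ) = 1 := by
    rw [← Complex.ofReal_mul, mul_one_div_cancel ht.ne', Complex.ofReal_one]
  rw [heq.deriv_eq, hderiv.deriv, hF]
  linear_combination (-Gs g n (arctan t)) * hpow' - Gs g n (arctan t) *
    (((1 + t ^ 2) ^ ((3 : ℝ) / 2) : ℝ) : ℂ) * (((1 + t ^ 2) ^ (-(3 : ℝ) / 2) : ℝ) : ℂ) * htc
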